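/- The function g(μ_y, σ_y) = μ_y·(1 − Φ(−μ_y/σ_y)) + (σ_y/√(2π))·e^{−(μ_y/σ_y)²/2}, defined for μ_y ∈ ℝ and σ_y > 0, is jointly convex in (μ_y, σ_y). -/

import Mathlib

/-- Standard normal CDF. -/
noncomputable def stdNormalCDF (t : ℝ) : ℝ :=
  ∫ s in Set.Iic t, Real.exp (-s ^ 2 / 2) / Real.sqrt (2 * Real.pi)

theorem tmjc_hasDeriv (u : ℝ) :
    HasDerivAt stdNormalCDF (Real.exp (-u ^ 2 / 2) / Real.sqrt (2 * Real.pi)) u := by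
  have hc : Continuous (fun s : ℝ => Real.exp (-s ^ 2 / 2) / Real.sqrt (2 * Real.pi)) := by
    fun_prop
  have hi : MeasureTheory.Integrable
      (fun s : ℝ => Real.exp (-s ^ 2 / 2) / Real.sqrt (2 * Real.pi)) := by
    have h := (integrable_exp_neg_mul_sq (b := 1 / 2) (by norm_num)).div_const
      (Real.sqrt (2 * Real.pi))
    refine h.congr (Filter.Eventually.of_forall fun s => ?_)
    show Real.exp _ / _ = Real.exp _ / _
    congr 2
    ring
  have h1 : HasDerivAt (fun t : ℝ => ∫ s in (0 : ℝ)..t,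
      Real.exp (-s ^ 2 / 2) / Real.sqrt (2 * Real.pi))
      (Real.exp (-u ^ 2 / 2) / Real.sqrt (2 * Real.pi)) u :=
    intervalIntegral.integral_hasDerivAt_right (hc.intervalIntegrable _ _)
      hc.stronglyMeasurable.stronglyMeasurableAtFilter hc.continuousAt
  have h2 : stdNormalCDF = fun t : ℝ => stdNormalCDF 0 + ∫ s in (0 : ℝ)..t,
      Real.exp (-s ^ 2 / 2) / Real.sqrt (2 * Real.pi) := by
    funext t
    rw [← intervalIntegral.integral_Iic_sub_Iic hi.integrableOn hi.integrableOn]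
    unfold stdNormalCDF
    ring
  rw [h2]
  exact h1.const_add _

theorem tmjc_key (u v : ℝ) :
    v * stdNormalCDF u + Real.exp (-u ^ 2 / 2) / Real.sqrt (2 * Real.pi) ≤
      v * stdNormalCDF v + Real.exp (-v ^ 2 / 2) / Real.sqrt (2 * Real.pi) := by
  set G : ℝ → ℝ := fun u => v * stdNormalCDF u + Real.exp (-u ^ 2 / 2) / Real.sqrt (2 * Real.pi)
    with hG
  have hd : ∀ x, HasDerivAt G ((v - x) * (Real.exp (-x ^ 2 / 2) / Real.sqrt (2 * Real.pi))) x := by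
    intro x
    have h1 : HasDerivAt (fun x : ℝ => -x ^ 2 / 2) (-x) x := by
      have := ((hasDerivAt_pow 2 x).neg).div_const 2
      refine this.congr_deriv ?_
      norm_num
      try ring
    have h2 := ((tmjc_hasDeriv x).const_mul v).add (h1.exp.div_const (Real.sqrt (2 * Real.pi)))
    refine h2.congr_deriv ?_
    ring
  have hp : ∀ x : ℝ, 0 ≤ Real.exp (-x ^ 2 / 2) / Real.sqrt (2 * Real.pi) := fun x => by positivity
  have hcont : Continuous G := continuous_iff_continuousAt.2 fun x => (hd x).continuousAt
  show G u ≤ G v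
  rcases le_total u v with h | h
  · refine monotoneOn_of_deriv_nonneg (convex_Iic v) hcont.continuousOn
      (fun x _ => (hd x).differentiableAt.differentiableWithinAt) ?_ h
      (Set.mem_Iic.2 le_rfl) h
    intro x hx
    rw [interior_Iic] at hx
    rw [(hd x).deriv]
    exact mul_nonneg (sub_nonneg.2 (le_of_lt hx)) (hp x)
  · refine antitoneOn_of_deriv_nonpos (convex_Ici v) hcont.continuousOn
      (fun x _ => (hd x).differentiableAt.differentiableWithinAt) ?_
      (Set.mem_Ici.2 le_rfl) h h
    intro x hx
    rw [interior_Ici] at hx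
    rw [(hd x).deriv]
    exact mul_nonpos_of_nonpos_of_nonneg (sub_nonpos.2 (le_of_lt hx)) (hp x)

theorem tmjc_lin (m s w : ℝ) (hs : 0 < s) :
    m * (1 - stdNormalCDF (-w)) + s / Real.sqrt (2 * Real.pi) * Real.exp (-w ^ 2 / 2) ≤
      m * (1 - stdNormalCDF (-m / s)) +
        s / Real.sqrt (2 * Real.pi) * Real.exp (-(m / s) ^ 2 / 2) := by
  have h := mul_le_mul_of_nonneg_left (tmjc_key (-w) (-m / s)) hs.le
  have e : (-m / s) ^ 2 = (m / s) ^ 2 := by ring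
  rw [neg_sq, e] at h
  have e2 : ∀ a b : ℝ, s * (-m / s * a + b / Real.sqrt (2 * Real.pi)) =
      -m * a + s / Real.sqrt (2 * Real.pi) * b := by
    intro a b
    have : s * (-m / s) = -m := by field_simp
    linear_combination a * this
  rw [e2, e2] at h
  linarith

/-- The function
`g(μ, σ) = μ (1 − Φ(−μ/σ)) + (σ/√(2π)) e^{−(μ/σ)²/2}`, defined for `μ ∈ ℝ` and
`σ > 0`, is jointly convex in `(μ, σ)`. -/
theorem truncated_mean_jointly_convex :
    ConvexOn ℝ {q : ℝ × ℝ | 0 < q.2}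
      (fun q : ℝ × ℝ =>
        q.1 * (1 - stdNormalCDF (-q.1 / q.2)) +
          q.2 / Real.sqrt (2 * Real.pi) * Real.exp (-(q.1 / q.2) ^ 2 / 2)) := by
  refine ⟨?_, ?_⟩
  · exact convex_halfSpace_gt (IsLinearMap.mk (fun _ _ => rfl) (fun _ _ => rfl)) 0
  · rintro ⟨m, s⟩ hs ⟨m', s'⟩ hs' a b ha hb hab
    simp only [Prod.smul_mk, Prod.mk_add_mk, smul_eq_mul, Set.mem_ofPred_eq] at *
    rw [neg_div]
    generalize (a * m + b * m') / (a * s + b * s') = w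
    have h1 := mul_le_mul_of_nonneg_left (tmjc_lin m s w hs) ha
    have h2 := mul_le_mul_of_nonneg_left (tmjc_lin m' s' w hs') hb
    refine le_trans (le_of_eq ?_) (add_le_add h1 h2)
    ring
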